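/- With the setup of the κ-minimization: integers 1 ≤ m < n, δ = (m−1)/n, 1 ≤ p ≤ ∞, λ ≤ t* where t* = t*_p(δ;n) solves δ = D_p(t) − (t/2)D_p'(t), α* = sqrt(D_p(t*)/(δ(δ−D_p(t*)))), A > α*, and κ(α) = max_{0 ≤ β ≤ 1} κ(α,β) with κ(α,β) = β·sqrt(δα²+1) − α·Δ_p(β). Then for every 0 < ε ≤ max(α*, A − α*), the infimum of κ(α) − κ(α*) over α ∈ [0,A] with |α − α*| ≥ ε equals its value over |α − α*| = ε and is at least ω(ε) := (ε²/2)·(λδ/t*)/(1 + δ(α* + ε)²)^{3/2}; moreover ω(ε) ≤ 1/2 in this range. -/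

import Mathlib

open MeasureTheory ProbabilityTheory Filter
open scoped ENNReal NNReal

/-- The standard Gaussian measure `N(0, I_n)` on `ℝ^n`. -/
noncomputable def stdGaussian (n : ℕ) : Measure (Fin n → ℝ) :=
  Measure.pi fun _ => gaussianReal 0 1

/-- The Euclidean (`ℓ²`) norm on `ℝ^n`. -/
noncomputable def l2norm {n : ℕ} (x : Fin n → ℝ) : ℝ := Real.sqrt (∑ i, x i ^ 2)

/-- The `ℓ^q` norm on `ℝ^n` for an extended exponent `q ∈ [1, ∞]`. -/
noncomputable def lqNorm {n : ℕ} (q : ℝ≥0∞) (x : Fin n → ℝ) : ℝ :=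
  if q = ⊤ then ⨆ i, |x i| else (∑ i, |x i| ^ q.toReal) ^ (1 / q.toReal)

/-- Euclidean distance from `h ∈ ℝ^n` to a set `C ⊆ ℝ^n`. -/
noncomputable def distL2 {n : ℕ} (C : Set (Fin n → ℝ)) (h : Fin n → ℝ) : ℝ :=
  sInf ((fun w => l2norm (h - w)) '' C)

/-- `D_p(t; n) = (1/n) (E_{h ∼ N(0,I_n)} dist(h, {x : ‖x‖_{p*} ≤ t}))²`, expressed in terms
of the Hölder conjugate exponent `q = p*`. -/
noncomputable def Dp (q : ℝ≥0∞) (n : ℕ) (t : ℝ) : ℝ :=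
  (1 / n) * (∫ h, distL2 {x | lqNorm q x ≤ t} h ∂stdGaussian n) ^ 2


/-- `Δ_p(β) = (1/√n) E_{h ∼ N(0,I_n)} dist(β h, {w : ‖w‖_{p*} ≤ λ})`, in terms of the
conjugate exponent `q = p*`. -/
noncomputable def Deltap (q : ℝ≥0∞) (lam : ℝ) (n : ℕ) (β : ℝ) : ℝ :=
  (1 / Real.sqrt n) * ∫ h, distL2 {w | lqNorm q w ≤ lam} (β • h) ∂stdGaussian n

/-- `κ(α, β) = β √(δα² + 1) − α Δ_p(β)`. -/
noncomputable def kappaFun (q : ℝ≥0∞) (lam : ℝ) (n : ℕ) (δ α β : ℝ) : ℝ :=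
  β * Real.sqrt (δ * α ^ 2 + 1) - α * Deltap q lam n β

/-- `κ(α) = max_{β ∈ [0,1]} κ(α, β)`. -/
noncomputable def kappaSup (q : ℝ≥0∞) (lam : ℝ) (n : ℕ) (δ α : ℝ) : ℝ :=
  sSup ((fun β => kappaFun q lam n δ α β) '' Set.Icc (0 : ℝ) 1)

section Norms

variable {n : ℕ}

lemma l2norm_eq_norm (x : Fin n → ℝ) : l2norm x = ‖WithLp.toLp 2 x‖ := by
  simp [l2norm, EuclideanSpace.norm_eq]

lemma l2norm_nonneg (x : Fin n → ℝ) : 0 ≤ l2norm x := Real.sqrt_nonneg _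

lemma l2norm_add_le (x y : Fin n → ℝ) : l2norm (x + y) ≤ l2norm x + l2norm y := by
  simp only [l2norm_eq_norm, WithLp.toLp_add]
  exact norm_add_le _ _

lemma l2norm_smul (c : ℝ) (x : Fin n → ℝ) : l2norm (c • x) = |c| * l2norm x := by
  simp only [l2norm_eq_norm, WithLp.toLp_smul, norm_smul, Real.norm_eq_abs]

lemma abs_apply_le_l2norm (x : Fin n → ℝ) (i : Fin n) : |x i| ≤ l2norm x := by
  rw [l2norm_eq_norm]
  exact PiLp.norm_apply_le (WithLp.toLp 2 x) i

lemma l2norm_le_sum_abs (x : Fin n → ℝ) : l2norm x ≤ ∑ i, |x i| := by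
  refine Real.sqrt_le_iff.2 ⟨Finset.sum_nonneg fun i _ => abs_nonneg _, ?_⟩
  simpa using Finset.sum_sq_le_sq_sum_of_nonneg (s := Finset.univ) (f := fun i => |x i|)
    fun i _ => abs_nonneg _

lemma l2norm_le_card_mul_norm (x : Fin n → ℝ) : l2norm x ≤ n * ‖x‖ := by
  refine (l2norm_le_sum_abs x).trans ?_
  refine (Finset.sum_le_sum fun i _ => norm_le_pi_norm x i).trans ?_
  simp

lemma continuous_l2norm : Continuous (l2norm : (Fin n → ℝ) → ℝ) := by
  unfold l2norm
  fun_prop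

lemma lqNorm_eq_norm {q : ℝ≥0∞} (hq : 1 ≤ q) (x : Fin n → ℝ) :
    lqNorm q x = ‖WithLp.toLp q x‖ := by
  unfold lqNorm
  split_ifs with h
  · subst h
    simp [PiLp.norm_eq_ciSup]
  · rw [PiLp.norm_eq_sum (ENNReal.toReal_pos (zero_lt_one.trans_le hq).ne' h)]
    simp

lemma lqNorm_zero {q : ℝ≥0∞} (hq : 1 ≤ q) : lqNorm q (0 : Fin n → ℝ) = 0 := by
  have : Fact (1 ≤ q) := ⟨hq⟩
  simp [lqNorm_eq_norm hq]

lemma lqNorm_add_le {q : ℝ≥0∞} (hq : 1 ≤ q) (x y : Fin n → ℝ) :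
    lqNorm q (x + y) ≤ lqNorm q x + lqNorm q y := by
  have : Fact (1 ≤ q) := ⟨hq⟩
  simp only [lqNorm_eq_norm hq, WithLp.toLp_add]
  exact norm_add_le _ _

lemma lqNorm_smul {q : ℝ≥0∞} (hq : 1 ≤ q) (c : ℝ) (x : Fin n → ℝ) :
    lqNorm q (c • x) = |c| * lqNorm q x := by
  have : Fact (1 ≤ q) := ⟨hq⟩
  simp only [lqNorm_eq_norm hq, WithLp.toLp_smul, norm_smul, Real.norm_eq_abs]

lemma abs_apply_le_lqNorm {q : ℝ≥0∞} (hq : 1 ≤ q) (x : Fin n → ℝ) (i : Fin n) :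
    |x i| ≤ lqNorm q x := by
  have : Fact (1 ≤ q) := ⟨hq⟩
  rw [lqNorm_eq_norm hq]
  exact PiLp.norm_apply_le (WithLp.toLp q x) i

end Norms

section Distance

variable {n : ℕ} {C : Set (Fin n → ℝ)}

lemma distL2_nonneg (C : Set (Fin n → ℝ)) (h : Fin n → ℝ) : 0 ≤ distL2 C h := by
  refine Real.sInf_nonneg ?_
  rintro _ ⟨w, -, rfl⟩
  exact l2norm_nonneg _

lemma distL2_le {w : Fin n → ℝ} (hw : w ∈ C) (h : Fin n → ℝ) : distL2 C h ≤ l2norm (h - w) :=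
  csInf_le ⟨0, by rintro _ ⟨w, -, rfl⟩; exact l2norm_nonneg _⟩ ⟨w, hw, rfl⟩

lemma le_distL2 (hC : C.Nonempty) {h : Fin n → ℝ} {a : ℝ}
    (H : ∀ w ∈ C, a ≤ l2norm (h - w)) : a ≤ distL2 C h := by
  refine le_csInf (hC.image _) ?_
  rintro _ ⟨w, hw, rfl⟩
  exact H w hw

lemma exists_l2norm_lt (hC : C.Nonempty) (h : Fin n → ℝ) {e : ℝ} (he : 0 < e) :
    ∃ w ∈ C, l2norm (h - w) < distL2 C h + e := by
  obtain ⟨_, ⟨w, hw, rfl⟩, hlt⟩ :=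
    exists_lt_of_csInf_lt (hC.image fun w => l2norm (h - w)) (lt_add_of_pos_right (distL2 C h) he)
  exact ⟨w, hw, hlt⟩

lemma distL2_eq_zero {h : Fin n → ℝ} (hh : h ∈ C) : distL2 C h = 0 :=
  le_antisymm (by simpa [l2norm] using distL2_le hh h) (distL2_nonneg _ _)

lemma distL2_sub_le (hC : C.Nonempty) (h h' : Fin n → ℝ) :
    distL2 C h - distL2 C h' ≤ l2norm (h - h') := by
  rw [sub_le_comm]
  refine le_distL2 hC fun w hw => ?_
  have h1 := distL2_le hw h
  have h2 := l2norm_add_le (h - h') (h' - w)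
  rw [sub_add_sub_cancel] at h2
  linarith

lemma abs_distL2_sub_le (hC : C.Nonempty) (h h' : Fin n → ℝ) :
    |distL2 C h - distL2 C h'| ≤ l2norm (h - h') := by
  refine abs_sub_le_iff.2 ⟨distL2_sub_le hC h h', ?_⟩
  have := distL2_sub_le hC h' h
  rwa [← neg_sub h h', ← neg_one_smul ℝ, l2norm_smul, abs_neg, abs_one, one_mul] at this

lemma lipschitzWith_distL2 (hC : C.Nonempty) : LipschitzWith n (distL2 C) := by
  refine LipschitzWith.of_dist_le_mul fun h h' => ?_
  rw [Real.dist_eq, dist_eq_norm]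
  exact (abs_distL2_sub_le hC h h').trans (by simpa using l2norm_le_card_mul_norm (h - h'))

end Distance

section Balls

variable {n : ℕ} {q : ℝ≥0∞}

lemma lqBall_nonempty (hq : 1 ≤ q) {t : ℝ} (ht : 0 ≤ t) :
    {x : Fin n → ℝ | lqNorm q x ≤ t}.Nonempty :=
  ⟨0, by simpa [lqNorm_zero hq] using ht⟩

lemma distL2_lqBall_le (hq : 1 ≤ q) {t : ℝ} (ht : 0 ≤ t) (h : Fin n → ℝ) :
    distL2 {x | lqNorm q x ≤ t} h ≤ l2norm h := by
  have h0 : (0 : Fin n → ℝ) ∈ {x : Fin n → ℝ | lqNorm q x ≤ t} := by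
    simpa [lqNorm_zero hq] using ht
  simpa using distL2_le h0 h

lemma distL2_lqBall_smul_le (hq : 1 ≤ q) {t c : ℝ} (ht : 0 ≤ t) (hc : 0 < c) (h : Fin n → ℝ) :
    distL2 {x | lqNorm q x ≤ c * t} (c • h) ≤ c * distL2 {x | lqNorm q x ≤ t} h := by
  rw [mul_comm c (distL2 _ _), ← div_le_iff₀ hc]
  refine le_distL2 (lqBall_nonempty hq ht) fun w hw => ?_
  rw [div_le_iff₀ hc]
  have hw' : c • w ∈ {x : Fin n → ℝ | lqNorm q x ≤ c * t} := by
    simpa [lqNorm_smul hq, abs_of_pos hc] using mul_le_mul_of_nonneg_left hw hc.le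
  have := distL2_le hw' (c • h)
  rw [← smul_sub, l2norm_smul, abs_of_pos hc] at this
  linarith

lemma distL2_lqBall_smul (hq : 1 ≤ q) {t c : ℝ} (ht : 0 ≤ t) (hc : 0 < c) (h : Fin n → ℝ) :
    distL2 {x | lqNorm q x ≤ c * t} (c • h) = c * distL2 {x | lqNorm q x ≤ t} h := by
  refine le_antisymm (distL2_lqBall_smul_le hq ht hc h) ?_
  have := distL2_lqBall_smul_le hq (mul_nonneg hc.le ht) (inv_pos.2 hc) (c • h)
  rw [inv_mul_cancel_left₀ hc.ne', inv_smul_smul₀ hc.ne', inv_mul_eq_div, le_div_iff₀ hc] at this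
  linarith

lemma distL2_lqBall_convex (hq : 1 ≤ q) (h : Fin n → ℝ) :
    ConvexOn ℝ (Set.Ici 0) fun t => distL2 {x | lqNorm q x ≤ t} h := by
  refine ⟨convex_Ici 0, fun s hs t ht a b ha hb hab => le_of_forall_pos_le_add fun e he => ?_⟩
  obtain ⟨x, hx, hxe⟩ := exists_l2norm_lt (lqBall_nonempty hq hs) h he
  obtain ⟨y, hy, hye⟩ := exists_l2norm_lt (lqBall_nonempty hq ht) h he
  have hmem : a • x + b • y ∈ {x : Fin n → ℝ | lqNorm q x ≤ a • s + b • t} := by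
    refine (lqNorm_add_le hq _ _).trans ?_
    rw [lqNorm_smul hq, lqNorm_smul hq, abs_of_nonneg ha, abs_of_nonneg hb]
    exact add_le_add (mul_le_mul_of_nonneg_left hx ha) (mul_le_mul_of_nonneg_left hy hb)
  refine (distL2_le hmem h).trans ?_
  have hsplit : h - (a • x + b • y) = a • (h - x) + b • (h - y) := by
    conv_lhs => rw [← one_smul ℝ h, ← hab]
    module
  rw [hsplit]
  refine (l2norm_add_le _ _).trans ?_
  rw [l2norm_smul, l2norm_smul, abs_of_nonneg ha, abs_of_nonneg hb, smul_eq_mul, smul_eq_mul]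
  have h1 := mul_le_mul_of_nonneg_left hxe.le ha
  have h2 := mul_le_mul_of_nonneg_left hye.le hb
  have h3 : a * e + b * e = e := by rw [← add_mul, hab, one_mul]
  linarith

end Balls

section Gaussian

variable {n : ℕ} {q : ℝ≥0∞}

instance : IsProbabilityMeasure (stdGaussian n) := by
  unfold _root_.stdGaussian
  infer_instance

instance : (stdGaussian n).IsOpenPosMeasure := by
  have : (gaussianReal 0 1).IsOpenPosMeasure :=
    (gaussianReal_absolutelyContinuous' 0 one_ne_zero).isOpenPosMeasure
  unfold _root_.stdGaussian
  infer_instance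

lemma pi_const_absolutelyContinuous {α : Type*} [MeasurableSpace α] {μ ν : Measure α}
    [SigmaFinite μ] [SigmaFinite ν] (h : μ ≪ ν) (n : ℕ) :
    Measure.pi (fun _ : Fin n => μ) ≪ Measure.pi fun _ : Fin n => ν := by
  induction n with
  | zero =>
    rw [Measure.pi_of_empty, Measure.pi_of_empty]
  | succ n ih =>
    rw [← ((measurePreserving_piFinSuccAbove (fun _ : Fin (n + 1) => μ) 0).symm).map_eq,
      ← ((measurePreserving_piFinSuccAbove (fun _ : Fin (n + 1) => ν) 0).symm).map_eq]
    exact (h.prod ih).map (MeasurableEquiv.measurable _)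

lemma stdGaussian_absolutelyContinuous (n : ℕ) : stdGaussian n ≪ volume :=
  pi_const_absolutelyContinuous (gaussianReal_absolutelyContinuous 0 one_ne_zero) n

lemma integrable_l2norm : Integrable l2norm (stdGaussian n) := by
  have hi : ∀ i : Fin n, Integrable (fun h : Fin n → ℝ => |h i|) (stdGaussian n) := fun i =>
    integrable_comp_eval (μ := fun _ : Fin n => gaussianReal 0 1) (i := i) (f := fun x => |x|)
      (((memLp_id_gaussianReal 1).integrable (by simp)).abs)
  refine (integrable_finsetSum Finset.univ fun i _ => hi i).mono'
    continuous_l2norm.aestronglyMeasurable (ae_of_all _ fun h => ?_)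
  rw [Real.norm_of_nonneg (l2norm_nonneg h)]
  exact l2norm_le_sum_abs h

/-- The Gaussian mean distance to the `ℓ^q` ball of radius `t`, normalised by `√n`. -/
noncomputable def meanDist (q : ℝ≥0∞) (n : ℕ) (t : ℝ) : ℝ :=
  (1 / Real.sqrt n) * ∫ h, distL2 {x | lqNorm q x ≤ t} h ∂stdGaussian n

lemma Dp_eq_meanDist_sq (q : ℝ≥0∞) (n : ℕ) (t : ℝ) : Dp q n t = meanDist q n t ^ 2 := by
  rw [Dp, meanDist, mul_pow, div_pow, Real.sq_sqrt n.cast_nonneg, one_pow]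

lemma integrable_distL2_lqBall (hq : 1 ≤ q) {t : ℝ} (ht : 0 ≤ t) :
    Integrable (distL2 {x | lqNorm q x ≤ t}) (stdGaussian n) := by
  refine integrable_l2norm.mono'
    (lipschitzWith_distL2 (lqBall_nonempty hq ht)).continuous.aestronglyMeasurable
    (ae_of_all _ fun h => ?_)
  rw [Real.norm_of_nonneg (distL2_nonneg _ _)]
  exact distL2_lqBall_le hq ht h

lemma convexOn_meanDist (hq : 1 ≤ q) : ConvexOn ℝ (Set.Ici 0) (meanDist q n) := by
  refine ⟨convex_Ici 0, fun s hs t ht a b ha hb hab => ?_⟩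
  have hs' := integrable_distL2_lqBall (n := n) hq hs
  have ht' := integrable_distL2_lqBall (n := n) hq ht
  have hst : 0 ≤ a • s + b • t := add_nonneg (mul_nonneg ha hs) (mul_nonneg hb ht)
  have key := integral_mono (integrable_distL2_lqBall (n := n) hq hst)
    ((hs'.const_mul a).add (ht'.const_mul b))
    fun h => (distL2_lqBall_convex hq h).2 hs ht ha hb hab
  rw [Pi.add_def, integral_add (hs'.const_mul a) (ht'.const_mul b), integral_const_mul,
    integral_const_mul] at key
  have := mul_le_mul_of_nonneg_left key (by positivity : 0 ≤ 1 / Real.sqrt n)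
  simp only [meanDist, smul_eq_mul] at this ⊢
  linarith

lemma meanDist_pos (hn : 0 < n) (hq : 1 ≤ q) {t : ℝ} (ht : 0 ≤ t) : 0 < meanDist q n t := by
  refine mul_pos (by positivity) ?_
  refine (integral_nonneg fun h => distL2_nonneg _ _).lt_of_ne' fun h0 => ?_
  rw [integral_eq_zero_iff_of_nonneg (fun h => distL2_nonneg _ _)
    (integrable_distL2_lqBall hq ht)] at h0
  have hcont := (lipschitzWith_distL2 (lqBall_nonempty (n := n) hq ht)).continuous
  have hzero := congrFun ((hcont.ae_eq_iff_eq (stdGaussian n) continuous_zero).1 h0)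
    fun _ => t + 1
  have hge : 1 ≤ distL2 {x | lqNorm q x ≤ t} (fun _ : Fin n => t + 1) := by
    refine le_distL2 (lqBall_nonempty hq ht) fun w hw => ?_
    have h1 := abs_apply_le_l2norm ((fun _ : Fin n => t + 1) - w) ⟨0, hn⟩
    have h2 := (abs_apply_le_lqNorm hq w ⟨0, hn⟩).trans hw
    rw [Pi.sub_apply] at h1
    linarith [le_abs_self (t + 1 - w ⟨0, hn⟩), le_abs_self (w ⟨0, hn⟩)]
  rw [hzero] at hge
  exact absurd hge (by simp)

lemma tendsto_meanDist_atTop (hq : 1 ≤ q) :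
    Tendsto (fun k : ℕ => meanDist q n k) atTop (nhds 0) := by
  have key : Tendsto (fun k : ℕ => ∫ h, distL2 {x | lqNorm q x ≤ (k : ℝ)} h ∂stdGaussian n) atTop
      (nhds (∫ _, (0 : ℝ) ∂stdGaussian n)) := by
    refine tendsto_integral_of_dominated_convergence l2norm
      (fun k => (integrable_distL2_lqBall hq k.cast_nonneg).aestronglyMeasurable)
      integrable_l2norm (fun k => ae_of_all _ fun h => ?_) (ae_of_all _ fun h => ?_)
    · rw [Real.norm_of_nonneg (distL2_nonneg _ _)]
      exact distL2_lqBall_le hq k.cast_nonneg h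
    · refine tendsto_const_nhds.congr' ?_
      filter_upwards [tendsto_natCast_atTop_atTop.eventually_ge_atTop (lqNorm q h)] with k hk
      exact (distL2_eq_zero hk).symm
  simpa [meanDist] using key.const_mul (1 / Real.sqrt n)

lemma differentiableAt_integral_smul {F : (Fin n → ℝ) → ℝ} {K : ℝ≥0} (hF : LipschitzWith K F) :
    DifferentiableAt ℝ (fun s : ℝ => ∫ h, F (s • h) ∂stdGaussian n) 1 := by
  have hnorm : Integrable (fun h : Fin n → ℝ => ‖h‖) (stdGaussian n) := by
    refine integrable_l2norm.mono' continuous_norm.aestronglyMeasurable (ae_of_all _ fun h => ?_)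
    rw [norm_norm]
    exact (pi_norm_le_iff_of_nonneg (l2norm_nonneg h)).2 (abs_apply_le_l2norm h)
  have hcont : ∀ s : ℝ, Continuous fun h : Fin n → ℝ => F (s • h) := fun s =>
    hF.continuous.comp (continuous_const_smul s)
  have hjoint : Continuous (Function.uncurry fun (h : Fin n → ℝ) (s : ℝ) => F (s • h)) :=
    hF.continuous.comp (continuous_snd.smul continuous_fst)
  refine (hasDerivAt_integral_of_dominated_loc_of_lip (F := fun (s : ℝ) h => F (s • h))
    (F' := fun h => deriv (fun s : ℝ => F (s • h)) 1) (bound := fun h => K * ‖h‖)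
    (s := Set.univ) univ_mem (Eventually.of_forall fun s => (hcont s).aestronglyMeasurable)
    ?_ ?_ (ae_of_all _ fun h => ?_) (hnorm.const_mul _) ?_).2.differentiableAt
  · refine ((hnorm.const_mul K).add (integrable_const |F 0|)).mono'
      (hcont 1).aestronglyMeasurable (ae_of_all _ fun h => ?_)
    have h1 := hF.dist_le_mul h 0
    rw [Real.dist_eq, dist_zero_right] at h1
    have h2 := abs_sub_abs_le_abs_sub (F h) (F 0)
    simp only [one_smul, Real.norm_eq_abs, Pi.add_apply]
    linarith
  · exact ((measurable_deriv_with_param hjoint).comp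
      (measurable_id.prodMk measurable_const)).aestronglyMeasurable
  · refine (LipschitzWith.of_dist_le_mul fun s t => ?_).lipschitzOnWith
    refine (hF.dist_le_mul _ _).trans_eq ?_
    rw [dist_eq_norm, ← sub_smul, norm_smul, ← dist_eq_norm, Real.coe_nnabs,
      abs_of_nonneg (by positivity)]
    ring
  · filter_upwards [(stdGaussian_absolutelyContinuous n).ae_le hF.ae_differentiableAt] with h hh
    refine DifferentiableAt.hasDerivAt ?_
    have hh' : DifferentiableAt ℝ F ((1 : ℝ) • h) := by rwa [one_smul]
    exact hh'.comp (f := fun s : ℝ => s • h) (1 : ℝ) (differentiableAt_id.smul_const h)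

lemma differentiableAt_meanDist (hq : 1 ≤ q) {t : ℝ} (ht : 0 < t) :
    DifferentiableAt ℝ (meanDist q n) t := by
  have hF := lipschitzWith_distL2 (lqBall_nonempty (n := n) hq ht.le)
  have hG : DifferentiableAt ℝ (fun s => (1 / Real.sqrt n) * (s / t *
      ∫ h, distL2 {x | lqNorm q x ≤ t} ((t / s) • h) ∂stdGaussian n)) t := by
    have h1 := differentiableAt_integral_smul hF
    rw [← div_self ht.ne'] at h1
    have h2 : DifferentiableAt ℝ (fun s => t / s) t :=
      (differentiableAt_const t).div differentiableAt_id ht.ne'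
    exact ((differentiableAt_id.div_const t).mul (h1.comp t h2)).const_mul _
  refine hG.congr_of_eventuallyEq ?_
  filter_upwards [eventually_gt_nhds ht] with s hs
  rw [meanDist, ← integral_const_mul (s / t)]
  congr 1
  refine integral_congr_ae (ae_of_all _ fun h => ?_)
  beta_reduce
  rw [← distL2_lqBall_smul hq ht.le (div_pos hs ht), div_mul_cancel₀ _ ht.ne', smul_smul,
    div_mul_div_cancel₀ ht.ne', div_self hs.ne', one_smul]

lemma meanDist_tangent_le (hq : 1 ≤ q) {t s : ℝ} (ht : 0 < t) (hs : 0 ≤ s) :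
    meanDist q n t + deriv (meanDist q n) t * (s - t) ≤ meanDist q n s := by
  have hd := (differentiableAt_meanDist (n := n) hq ht).hasDerivAt
  have hc := convexOn_meanDist (n := n) hq
  rcases lt_trichotomy s t with h | h | h
  · have := hc.slope_le_of_hasDerivAt hs ht.le h hd
    rw [slope_def_field, div_le_iff₀ (sub_pos.2 h)] at this
    linarith
  · simp [h]
  · have := hc.le_slope_of_hasDerivAt ht.le hs h hd
    rw [slope_def_field, le_div_iff₀ (sub_pos.2 h)] at this
    linarith

lemma deriv_meanDist_neg (hn : 0 < n) (hq : 1 ≤ q) {t : ℝ} (ht : 0 < t) :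
    deriv (meanDist q n) t < 0 := by
  by_contra! h
  refine (meanDist_pos hn hq ht.le).not_ge (ge_of_tendsto (tendsto_meanDist_atTop (n := n) hq) ?_)
  filter_upwards [tendsto_natCast_atTop_atTop.eventually_ge_atTop t] with k hk
  have := meanDist_tangent_le (n := n) hq ht k.cast_nonneg
  linarith [mul_nonneg h (sub_nonneg.2 hk)]

lemma deriv_Dp (hq : 1 ≤ q) {t : ℝ} (ht : 0 < t) :
    deriv (Dp q n) t = 2 * meanDist q n t * deriv (meanDist q n) t := by
  rw [funext (Dp_eq_meanDist_sq q n)]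
  simpa using ((differentiableAt_meanDist (n := n) hq ht).hasDerivAt.fun_pow 2).deriv

end Gaussian

section Kappa

variable {n : ℕ} {q : ℝ≥0∞} {lam δ : ℝ}

lemma Deltap_nonneg (q : ℝ≥0∞) (lam : ℝ) (n : ℕ) (β : ℝ) : 0 ≤ Deltap q lam n β :=
  mul_nonneg (by positivity) (integral_nonneg fun _ => distL2_nonneg _ _)

lemma Deltap_zero (hq : 1 ≤ q) (hlam : 0 ≤ lam) : Deltap q lam n 0 = 0 := by
  have h0 : (0 : Fin n → ℝ) ∈ {x : Fin n → ℝ | lqNorm q x ≤ lam} := by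
    simpa [lqNorm_zero hq] using hlam
  simp [Deltap, distL2_eq_zero h0]

lemma Deltap_eq_mul_meanDist (hq : 1 ≤ q) (hlam : 0 ≤ lam) {β : ℝ} (hβ : 0 < β) :
    Deltap q lam n β = β * meanDist q n (lam / β) := by
  rw [Deltap, meanDist, mul_left_comm, ← integral_const_mul β]
  congr 1
  refine integral_congr_ae (ae_of_all _ fun h => ?_)
  beta_reduce
  rw [← distL2_lqBall_smul hq (div_nonneg hlam hβ.le) hβ, mul_div_cancel₀ _ hβ.ne']

lemma Deltap_div (hq : 1 ≤ q) (hlam : 0 ≤ lam) {t : ℝ} (ht : 0 < t) :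
    Deltap q lam n (lam / t) = lam / t * meanDist q n t := by
  rcases hlam.eq_or_lt with rfl | h
  · simp [Deltap_zero hq le_rfl]
  · rw [Deltap_eq_mul_meanDist hq hlam (div_pos h ht), div_div_cancel₀ h.ne']

lemma le_Deltap (hn : 0 < n) (hq : 1 ≤ q) (hlam : 0 ≤ lam) {t β : ℝ} (ht : 0 < t) (hβ : 0 ≤ β) :
    β * (meanDist q n t - t * deriv (meanDist q n) t) + lam * deriv (meanDist q n) t ≤
      Deltap q lam n β := by
  rcases hβ.eq_or_lt with rfl | h
  · rw [Deltap_zero hq hlam]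
    linarith [mul_nonpos_of_nonneg_of_nonpos hlam (deriv_meanDist_neg hn hq ht).le]
  · rw [Deltap_eq_mul_meanDist hq hlam h]
    have := mul_le_mul_of_nonneg_left
      (meanDist_tangent_le (n := n) hq ht (div_nonneg hlam hβ)) hβ
    have e : β * (lam / β) = lam := mul_div_cancel₀ _ h.ne'
    refine le_trans (le_of_eq ?_) this
    linear_combination (-deriv (meanDist q n) t) * e

lemma bddAbove_kappaFun {α : ℝ} (hα : 0 ≤ α) :
    BddAbove ((fun β => kappaFun q lam n δ α β) '' Set.Icc (0 : ℝ) 1) := by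
  refine ⟨Real.sqrt (δ * α ^ 2 + 1), ?_⟩
  rintro _ ⟨β, hβ, rfl⟩
  have h1 := mul_le_mul_of_nonneg_right hβ.2 (Real.sqrt_nonneg (δ * α ^ 2 + 1))
  have h2 := mul_nonneg hα (Deltap_nonneg q lam n β)
  simp only [kappaFun]
  linarith

lemma kappaFun_le_kappaSup {α β : ℝ} (hα : 0 ≤ α) (hβ : β ∈ Set.Icc (0 : ℝ) 1) :
    kappaFun q lam n δ α β ≤ kappaSup q lam n δ α :=
  le_csSup (bddAbove_kappaFun hα) ⟨β, hβ, rfl⟩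

lemma kappaSup_le {α M : ℝ} (h : ∀ β ∈ Set.Icc (0 : ℝ) 1, kappaFun q lam n δ α β ≤ M) :
    kappaSup q lam n δ α ≤ M := by
  refine csSup_le ((Set.nonempty_Icc.2 zero_le_one).image _) ?_
  rintro _ ⟨β, hβ, rfl⟩
  exact h β hβ

lemma convexOn_sqrt_mul_sq_add_one (hδ : 0 ≤ δ) :
    ConvexOn ℝ Set.univ fun α : ℝ => Real.sqrt (δ * α ^ 2 + 1) := by
  refine ⟨convex_univ, fun x _ y _ a b ha hb hab => ?_⟩
  simp only [smul_eq_mul]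
  have hx := Real.sq_sqrt (by positivity : 0 ≤ δ * x ^ 2 + 1)
  have hy := Real.sq_sqrt (by positivity : 0 ≤ δ * y ^ 2 + 1)
  refine Real.sqrt_le_iff.2 ⟨by positivity, ?_⟩
  have hxy : δ * x * y + 1 ≤ Real.sqrt (δ * x ^ 2 + 1) * Real.sqrt (δ * y ^ 2 + 1) := by
    rw [← Real.sqrt_mul (by positivity)]
    refine Real.le_sqrt_of_sq_le ?_
    nlinarith [mul_nonneg hδ (sq_nonneg (x - y))]
  have hb' : b = 1 - a := by linarith
  subst hb'
  linear_combination 2 * mul_le_mul_of_nonneg_left hxy (mul_nonneg ha hb) - a ^ 2 * hx -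
    (1 - a) ^ 2 * hy

lemma convexOn_kappaSup (hδ : 0 ≤ δ) : ConvexOn ℝ (Set.Ici 0) (kappaSup q lam n δ) := by
  refine ⟨convex_Ici 0, fun x hx y hy a b ha hb hab => kappaSup_le fun β hβ => ?_⟩
  have h1 := mul_le_mul_of_nonneg_left
    ((convexOn_sqrt_mul_sq_add_one hδ).2 (Set.mem_univ x) (Set.mem_univ y) ha hb hab) hβ.1
  have h2 := mul_le_mul_of_nonneg_left
    (kappaFun_le_kappaSup (q := q) (lam := lam) (n := n) (δ := δ) hx hβ) ha
  have h3 := mul_le_mul_of_nonneg_left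
    (kappaFun_le_kappaSup (q := q) (lam := lam) (n := n) (δ := δ) hy hβ) hb
  simp only [kappaFun, smul_eq_mul] at h1 h2 h3 ⊢
  linarith

end Kappa

section Growth

/-- The remainder of the tangent line of `α ↦ √(δα² + 1)` at `a`. -/
lemma sqrt_tangent_remainder {δ a α : ℝ} (hδ : 0 ≤ δ) (ha : 0 ≤ a) (hα : 0 ≤ α) {c : ℝ}
    (hc : c * Real.sqrt (δ * a ^ 2 + 1) = δ * a) :
    (Real.sqrt (δ * α ^ 2 + 1) - α * c) - (Real.sqrt (δ * a ^ 2 + 1) - a * c) =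
      δ * (α - a) ^ 2 / (Real.sqrt (δ * a ^ 2 + 1) *
        (Real.sqrt (δ * α ^ 2 + 1) * Real.sqrt (δ * a ^ 2 + 1) + 1 + δ * a * α)) := by
  have hu := Real.sq_sqrt (by positivity : 0 ≤ δ * α ^ 2 + 1)
  have hv := Real.sq_sqrt (by positivity : 0 ≤ δ * a ^ 2 + 1)
  have hv0 : 0 < Real.sqrt (δ * a ^ 2 + 1) := Real.sqrt_pos.2 (by positivity)
  set u := Real.sqrt (δ * α ^ 2 + 1)
  set v := Real.sqrt (δ * a ^ 2 + 1)
  have hu0 : 0 ≤ u := Real.sqrt_nonneg _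
  rw [eq_div_iff (by positivity)]
  have e : ((u - α * c) - (v - a * c)) * v = u * v - 1 - δ * a * α := by
    linear_combination (a - α) * hc - hv
  calc _ = (((u - α * c) - (v - a * c)) * v) * (u * v + 1 + δ * a * α) := by ring
    _ = _ := by
      rw [e]
      linear_combination v ^ 2 * hu + (δ * α ^ 2 + 1) * hv

lemma quadratic_growth {δ a α ε c : ℝ} (hδ : 0 ≤ δ) (ha : 0 ≤ a) (hα : 0 ≤ α)
    (hε : |α - a| = ε) (hc : c * Real.sqrt (δ * a ^ 2 + 1) = δ * a) :
    ε ^ 2 / 2 * δ / (1 + δ * (a + ε) ^ 2) ^ ((3 : ℝ) / 2) ≤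
      (Real.sqrt (δ * α ^ 2 + 1) - α * c) - (Real.sqrt (δ * a ^ 2 + 1) - a * c) := by
  rw [sqrt_tangent_remainder hδ ha hα hc]
  have hε0 : 0 ≤ ε := hε ▸ abs_nonneg _
  have hαR : α ≤ a + ε := by linarith [le_abs_self (α - a)]
  set w := Real.sqrt (δ * (a + ε) ^ 2 + 1) with hw_def
  have hw := Real.sq_sqrt (by positivity : 0 ≤ δ * (a + ε) ^ 2 + 1)
  rw [← hw_def] at hw
  have hw0 : 0 ≤ w := Real.sqrt_nonneg _
  have huw : Real.sqrt (δ * α ^ 2 + 1) ≤ w := Real.sqrt_le_sqrt (by gcongr)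
  have hvw : Real.sqrt (δ * a ^ 2 + 1) ≤ w := Real.sqrt_le_sqrt (by gcongr; linarith)
  have hv0 : 0 < Real.sqrt (δ * a ^ 2 + 1) := Real.sqrt_pos.2 (by positivity)
  have hpow : (1 + δ * (a + ε) ^ 2) ^ ((3 : ℝ) / 2) = w ^ 3 := by
    rw [hw_def, Real.sqrt_eq_rpow, ← Real.rpow_mul_natCast (by positivity), add_comm]
    norm_num
  have haα : 1 + δ * a * α ≤ w ^ 2 := by
    rw [hw]
    have : a * α ≤ (a + ε) * (a + ε) := by gcongr; linarith
    nlinarith [mul_le_mul_of_nonneg_left this hδ]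
  have hden : Real.sqrt (δ * a ^ 2 + 1) *
      (Real.sqrt (δ * α ^ 2 + 1) * Real.sqrt (δ * a ^ 2 + 1) + 1 + δ * a * α) ≤ 2 * w ^ 3 := by
    calc _ ≤ w * (w * w + w ^ 2) := by
          rw [add_assoc]
          gcongr
      _ = 2 * w ^ 3 := by ring
  rw [hpow, ← hε, sq_abs]
  calc _ = δ * (α - a) ^ 2 / (2 * w ^ 3) := by
        field_simp
    _ ≤ _ := by gcongr

lemma growth_bound_le_half {δ a ε β : ℝ} (hδ : 0 ≤ δ) (ha : 0 ≤ a) (hε : 0 ≤ ε) (hβ : β ≤ 1) :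
    ε ^ 2 / 2 * (β * δ) / (1 + δ * (a + ε) ^ 2) ^ ((3 : ℝ) / 2) ≤ 1 / 2 := by
  have h1 : 1 + δ * (a + ε) ^ 2 ≤ (1 + δ * (a + ε) ^ 2) ^ ((3 : ℝ) / 2) :=
    Real.self_le_rpow_of_one_le (by linarith [mul_nonneg hδ (sq_nonneg (a + ε))]) (by norm_num)
  rw [div_le_iff₀ (by positivity)]
  have h2 : β * δ ≤ δ := mul_le_of_le_one_left hδ hβ
  have h3 : δ * ε ^ 2 ≤ δ * (a + ε) ^ 2 := by gcongr; linarith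
  nlinarith [mul_le_mul_of_nonneg_left h2 (sq_nonneg ε)]

/-- For a convex function on `[0, ∞)` with minimizer `a` over `[0, A]`, the infimum over the points
of `[0, A]` at distance at least `ε` from `a` is attained at distance exactly `ε`. -/
lemma sInf_image_far_eq_sInf_image_sphere {f : ℝ → ℝ} (hf : ConvexOn ℝ (Set.Ici 0) f) {a A ε : ℝ}
    (ha : 0 ≤ a) (haA : a ≤ A) (hε : 0 < ε) (hmin : ∀ α ∈ Set.Icc 0 A, f a ≤ f α)
    (hne : {α : ℝ | α ∈ Set.Icc (0 : ℝ) A ∧ |α - a| = ε}.Nonempty) :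
    sInf ((fun α => f α - f a) '' {α : ℝ | α ∈ Set.Icc (0 : ℝ) A ∧ ε ≤ |α - a|}) =
      sInf ((fun α => f α - f a) '' {α : ℝ | α ∈ Set.Icc (0 : ℝ) A ∧ |α - a| = ε}) := by
  have hsub : {α : ℝ | α ∈ Set.Icc (0 : ℝ) A ∧ |α - a| = ε} ⊆
      {α : ℝ | α ∈ Set.Icc (0 : ℝ) A ∧ ε ≤ |α - a|} := fun α hα => ⟨hα.1, hα.2.ge⟩
  have hbdd : ∀ S ⊆ Set.Icc (0 : ℝ) A, BddBelow ((fun α => f α - f a) '' S) := by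
    rintro S hS
    refine ⟨0, ?_⟩
    rintro _ ⟨α, hα, rfl⟩
    exact sub_nonneg.2 (hmin α (hS hα))
  refine le_antisymm (csInf_le_csInf (hbdd _ fun α hα => hα.1) (hne.image _)
    (Set.image_mono hsub)) (le_csInf ((hne.mono hsub).image _) ?_)
  rintro _ ⟨α, ⟨hα, hαε⟩, rfl⟩
  have hr : 0 < |α - a| := hε.trans_le hαε
  set θ := ε / |α - a| with hθ
  have hθ0 : 0 ≤ θ := by positivity
  have hθ1 : θ ≤ 1 := (div_le_one hr).2 hαε
  set γ := (1 - θ) • a + θ • α with hγ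
  have hγmem : γ ∈ Set.Icc 0 A :=
    (convex_Icc (0 : ℝ) A) (Set.mem_Icc.2 ⟨ha, haA⟩) hα (sub_nonneg.2 hθ1) hθ0 (by ring)
  have hγdist : |γ - a| = ε := by
    have : γ - a = θ * (α - a) := by simp only [hγ, smul_eq_mul]; ring
    rw [this, abs_mul, abs_of_nonneg hθ0, hθ, div_mul_cancel₀ _ hr.ne']
  have hγsphere : γ ∈ {α : ℝ | α ∈ Set.Icc (0 : ℝ) A ∧ |α - a| = ε} := ⟨hγmem, hγdist⟩
  refine (csInf_le (hbdd _ fun α hα => hα.1) (Set.mem_image_of_mem _ hγsphere)).trans ?_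
  have h1 := hf.2 ha hα.1 (sub_nonneg.2 hθ1) hθ0 (by ring)
  rw [← hγ, smul_eq_mul, smul_eq_mul] at h1
  have h2 := mul_nonneg (sub_nonneg.2 hθ1) (sub_nonneg.2 (hmin α hα))
  simp only
  linarith

end Growth

/-- Quadratic growth of `κ(α) = max_{β ∈ [0,1]} κ(α, β)` away from its
minimizer `α*`: for `0 < ε ≤ max(α*, A − α*)`, the infimum of `κ(α) − κ(α*)` over
`α ∈ [0, A]` with `|α − α*| ≥ ε` equals its value over `|α − α*| = ε` and is at least
`ω(ε) = (ε²/2) (λδ/t*) / (1 + δ(α* + ε)²)^{3/2}`; moreover `ω(ε) ≤ 1/2`.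
Here `t* = t*_p(δ; n)` is the unique positive solution of `δ = D_p(t) − (t/2) D_p'(t)`,
`α* = sqrt(D_p(t*)/(δ(δ − D_p(t*))))`, and `q = p*` is the Hölder conjugate of `p`. -/
theorem kappa_growth_away_from_minimizer (m n : ℕ) (hm : 1 ≤ m) (hmn : m < n)
    (p q : ℝ≥0∞) (hp : 1 ≤ p) (hpq : 1 / p + 1 / q = 1)
    (δ : ℝ) (hδ : δ = ((m : ℝ) - 1) / n)
    (tstar : ℝ) (htpos : 0 < tstar)
    (hteq : δ = Dp q n tstar - (tstar / 2) * deriv (Dp q n) tstar)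
    (htuniq : ∀ s : ℝ, 0 < s →
      δ = Dp q n s - (s / 2) * deriv (Dp q n) s → s = tstar)
    (lam : ℝ) (hlam0 : 0 ≤ lam) (hlam : lam ≤ tstar)
    (αstar : ℝ) (hαstar : αstar = Real.sqrt (Dp q n tstar / (δ * (δ - Dp q n tstar))))
    (A : ℝ) (hA : αstar < A)
    (ε : ℝ) (hε0 : 0 < ε) (hε : ε ≤ max αstar (A - αstar)) :
    sInf ((fun α => kappaSup q lam n δ α - kappaSup q lam n δ αstar) ''
        {α : ℝ | α ∈ Set.Icc (0 : ℝ) A ∧ ε ≤ |α - αstar|}) =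
      sInf ((fun α => kappaSup q lam n δ α - kappaSup q lam n δ αstar) ''
        {α : ℝ | α ∈ Set.Icc (0 : ℝ) A ∧ |α - αstar| = ε}) ∧
    ε ^ 2 / 2 * (lam * δ / tstar) / (1 + δ * (αstar + ε) ^ 2) ^ ((3 : ℝ) / 2) ≤
      sInf ((fun α => kappaSup q lam n δ α - kappaSup q lam n δ αstar) ''
        {α : ℝ | α ∈ Set.Icc (0 : ℝ) A ∧ ε ≤ |α - αstar|}) ∧
    ε ^ 2 / 2 * (lam * δ / tstar) / (1 + δ * (αstar + ε) ^ 2) ^ ((3 : ℝ) / 2) ≤ 1 / 2 := by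
  have hn : 0 < n := by omega
  have hq : 1 ≤ q := by
    have h : 1 / q ≤ 1 := le_add_self.trans_eq hpq
    rwa [one_div, ENNReal.inv_le_one] at h
  set G := meanDist q n tstar with hG
  set d := deriv (meanDist q n) tstar with hd
  have hGpos : 0 < G := meanDist_pos hn hq htpos.le
  have hdneg : d < 0 := deriv_meanDist_neg hn hq htpos
  rw [deriv_Dp hq htpos, Dp_eq_meanDist_sq, ← hG, ← hd] at hteq
  rw [Dp_eq_meanDist_sq, ← hG] at hαstar
  have htd : 0 < -(tstar * d) := neg_pos.2 (mul_neg_of_pos_of_neg htpos hdneg)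
  have hδG : δ = G * (G - tstar * d) := by rw [hteq]; ring
  have hδpos : 0 < δ := hδG ▸ mul_pos hGpos (by linarith)
  have hgap : δ - G ^ 2 = G * -(tstar * d) := by rw [hδG]; ring
  have hgap0 : 0 < δ - G ^ 2 := hgap ▸ mul_pos hGpos htd
  have ha0 : 0 ≤ αstar := hαstar ▸ Real.sqrt_nonneg _
  have hasq : αstar ^ 2 = G ^ 2 / (δ * (δ - G ^ 2)) := by
    rw [hαstar, Real.sq_sqrt (by positivity)]
  have hv : Real.sqrt (δ * αstar ^ 2 + 1) = αstar * (G - tstar * d) := by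
    rw [Real.sqrt_eq_iff_mul_self_eq (by positivity) (mul_nonneg ha0 (by linarith))]
    have e : G - tstar * d = δ / G := by rw [hδG]; field_simp
    rw [e]
    rw [eq_div_iff (by positivity)] at hasq
    field_simp
    linear_combination -hasq
  have hc : G * Real.sqrt (δ * αstar ^ 2 + 1) = δ * αstar := by rw [hv, hδG]; ring
  have hβmem : lam / tstar ∈ Set.Icc (0 : ℝ) 1 :=
    ⟨div_nonneg hlam0 htpos.le, (div_le_one htpos).2 hlam⟩
  have hgrow : ∀ α : ℝ, 0 ≤ α → lam / tstar * ((Real.sqrt (δ * α ^ 2 + 1) - α * G) -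
      (Real.sqrt (δ * αstar ^ 2 + 1) - αstar * G)) ≤
      kappaSup q lam n δ α - kappaSup q lam n δ αstar := by
    intro α hα
    have hlow := kappaFun_le_kappaSup (q := q) (lam := lam) (n := n) (δ := δ) hα hβmem
    rw [kappaFun, Deltap_div hq hlam0 htpos, ← hG] at hlow
    have hup : kappaSup q lam n δ αstar ≤ -(αstar * (lam * d)) := by
      refine kappaSup_le fun β hβ => ?_
      have := mul_le_mul_of_nonneg_left (le_Deltap hn hq hlam0 htpos hβ.1) ha0
      rw [kappaFun, hv]
      linarith
    have e : lam / tstar * (Real.sqrt (δ * αstar ^ 2 + 1) - αstar * G) =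
        -(αstar * (lam * d)) := by
      rw [hv]
      field_simp
      ring
    linarith
  have hsphere : ∀ α : ℝ, 0 ≤ α → ∀ r : ℝ, |α - αstar| = r →
      r ^ 2 / 2 * (lam * δ / tstar) / (1 + δ * (αstar + r) ^ 2) ^ ((3 : ℝ) / 2) ≤
        kappaSup q lam n δ α - kappaSup q lam n δ αstar := by
    intro α hα r hr
    refine le_trans (le_of_eq ?_) ((mul_le_mul_of_nonneg_left
      (quadratic_growth hδpos.le ha0 hα hr hc) hβmem.1).trans (hgrow α hα))
    ring
  have hmin : ∀ α ∈ Set.Icc 0 A, kappaSup q lam n δ αstar ≤ kappaSup q lam n δ α := by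
    intro α hα
    have h := hsphere α hα.1 _ rfl
    refine sub_nonneg.1 (le_trans ?_ h)
    positivity
  have hne : {α : ℝ | α ∈ Set.Icc (0 : ℝ) A ∧ |α - αstar| = ε}.Nonempty := by
    rcases le_max_iff.1 hε with h | h
    · exact ⟨αstar - ε, ⟨by linarith, by linarith⟩, by simp [abs_of_pos hε0]⟩
    · exact ⟨αstar + ε, ⟨by linarith, by linarith⟩, by simp [abs_of_pos hε0]⟩
  have hinf := sInf_image_far_eq_sInf_image_sphere (convexOn_kappaSup hδpos.le) ha0 hA.le hε0
    hmin hne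
  refine ⟨hinf, ?_, ?_⟩
  · rw [hinf]
    refine le_csInf (hne.image _) ?_
    rintro _ ⟨α, ⟨hα, hαε⟩, rfl⟩
    exact hsphere α hα.1 ε hαε
  · rw [mul_div_right_comm lam]
    exact growth_bound_le_half hδpos.le ha0 hε0.le hβmem.2
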